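/- arXiv:2006.05157 — 3 statements merged into one kernel-verified Lean document; each statement's English description precedes it below -/
import Mathlib

section
/- Let FI(B) be the category with objects the natural numbers and with Hom(n, m) the set of injective SupBotHoms (Fin n → Bool) → (Fin m → Bool) admitting a SupBotHom left inverse (splittable injections of free B-modules), with composition of functions. Then FI(B) is locally Noetherian: for every left-Noetherian ring k and every finitely generated functor F : FI(B) ⥤ ModuleCat k, every subfunctor of F is finitely generated. -/
open CategoryTheory

/-- A functor `F : C ⥤ ModuleCat k` is finitely generated if finitely many elements
`α_j ∈ F(Z_j)` exist such that every `F(W)` is the `k`-span of their images. -/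
def FunctorFG {C : Type*} [Category C] {k : Type} [Ring k]
    (F : C ⥤ ModuleCat.{0} k) : Prop :=
  ∃ (ℓ : ℕ) (Z : Fin ℓ → C) (α : ∀ j, F.obj (Z j)),
    ∀ W : C, (⊤ : Submodule k (F.obj W)) =
      Submodule.span k {v | ∃ (j : Fin ℓ) (h : Z j ⟶ W), v = F.map h (α j)}

/-- A subfunctor of `F`: a choice of submodules closed under all the maps `F(h)`. -/
def IsSubfunctor {C : Type*} [Category C] {k : Type} [Ring k]
    (F : C ⥤ ModuleCat.{0} k) (M : ∀ Z : C, Submodule k (F.obj Z)) : Prop :=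
  ∀ ⦃Z W : C⦄ (h : Z ⟶ W) (x : F.obj Z), x ∈ M Z → F.map h x ∈ M W

/-- A subfunctor `M` of `F` is finitely generated if finitely many elements
`α_j ∈ M(Z_j)` exist such that every `M(W)` is the `k`-span of their images. -/
def SubfunctorFG {C : Type*} [Category C] {k : Type} [Ring k]
    (F : C ⥤ ModuleCat.{0} k) (M : ∀ Z : C, Submodule k (F.obj Z)) : Prop :=
  ∃ (ℓ : ℕ) (Z : Fin ℓ → C) (α : ∀ j, F.obj (Z j)),
    (∀ j, α j ∈ M (Z j)) ∧
    ∀ W : C, M W = Submodule.span k {v | ∃ (j : Fin ℓ) (h : Z j ⟶ W), v = F.map h (α j)}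

/-- A category is locally Noetherian if for every left-Noetherian ring `k`, every
subfunctor of every finitely generated functor `C ⥤ ModuleCat k` is finitely
generated. -/
def LocallyNoetherian (C : Type*) [Category C] : Prop :=
  ∀ (k : Type) [Ring k] [IsNoetherianRing k] (F : C ⥤ ModuleCat.{0} k),
    FunctorFG F → ∀ M : ∀ Z : C, Submodule k (F.obj Z), IsSubfunctor F M → SubfunctorFG F M

/-- Objects of the category `FI(B)`: natural numbers, indexing the free B-modules
`Fin n → Bool`. -/
structure FIB : Type where
  n : ℕ

/-- The category `FI(B)`: morphisms `a ⟶ b` are the splittable injections of free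
B-modules, i.e. injective `SupBotHom`s `(Fin a → Bool) → (Fin b → Bool)` admitting a
`SupBotHom` left inverse. -/
instance : Category.{0} FIB where
  Hom a b := {f : SupBotHom (Fin a.n → Bool) (Fin b.n → Bool) //
    Function.Injective f ∧
      ∃ t : SupBotHom (Fin b.n → Bool) (Fin a.n → Bool), ∀ x, t (f x) = x}
  id a := ⟨SupBotHom.id _, fun _ _ h => h, ⟨SupBotHom.id _, fun _ => rfl⟩⟩
  comp f g := ⟨g.1.comp f.1, fun _ _ h => f.2.1 (g.2.1 h),
    ⟨(f.2.2.choose).comp g.2.2.choose, fun x => by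
      have hf := f.2.2.choose_spec
      have hg := g.2.2.choose_spec
      simp [hf, hg]⟩⟩
  id_comp f := Subtype.ext (SupBotHom.comp_id f.1)
  comp_id f := Subtype.ext (SupBotHom.id_comp f.1)
  assoc f g h := Subtype.ext (SupBotHom.comp_assoc h.1 g.1 f.1).symm

/-- Groebner-style argument: a family of submodules of free modules on well-quasi-ordered bases,
closed under the strictly monotone maps in `H`, is generated in finitely many degrees. -/
theorem fib_core {k : Type} [Ring k] [IsNoetherianRing k] (X : ℕ → Type)
    [∀ m, LinearOrder (X m)] [∀ m, Finite (X m)] (H : ∀ m m', Set (X m → X m'))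
    (mono : ∀ m m' h, h ∈ H m m' → StrictMono h)
    (wqo : ∀ s : ℕ → Σ m, X m, ∃ g : ℕ → ℕ, StrictMono g ∧ ∀ i j, i ≤ j →
      ∃ h ∈ H (s (g i)).1 (s (g j)).1, (s (g j)).2 = h (s (g i)).2)
    (N : ∀ m, Submodule k (X m →₀ k))
    (hN : ∀ m m' h, h ∈ H m m' → ∀ p ∈ N m, Finsupp.mapDomain h p ∈ N m') :
    ∃ D : Finset ℕ, ∀ m, N m ≤ Submodule.span k
      {q | ∃ m0 ∈ D, ∃ h ∈ H m0 m, ∃ p ∈ N m0, q = Finsupp.mapDomain h p} := by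
  classical
  let U : ∀ x : Σ m, X m, Submodule k (X x.1 →₀ k) := fun x =>
    N x.1 ⊓ Finsupp.supported k k (Set.Iic x.2)
  let I : (Σ m, X m) → Submodule k k := fun x => (U x).map (Finsupp.lapply x.2)
  have push : ∀ (x y : Σ m, X m) (h : X x.1 → X y.1), h ∈ H x.1 y.1 → y.2 = h x.2 →
      ∀ p ∈ U x, Finsupp.mapDomain h p ∈ U y ∧ Finsupp.mapDomain h p y.2 = p x.2 := by
    intro x y h hh hxy p hp
    refine ⟨⟨hN _ _ h hh p hp.1, ?_⟩, ?_⟩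
    · rw [SetLike.mem_coe, Finsupp.mem_supported]
      intro z hz
      obtain ⟨w, hw, rfl⟩ := Finset.mem_image.1 (Finsupp.mapDomain_support hz)
      have h2 := (Finsupp.mem_supported _ _).1 hp.2 hw
      rw [Set.mem_Iic] at h2 ⊢
      rw [hxy]
      exact (mono _ _ h hh).monotone h2
    · rw [hxy, Finsupp.mapDomain_apply (mono _ _ h hh).injective]
  have Imono : ∀ (x y : Σ m, X m) (h : X x.1 → X y.1), h ∈ H x.1 y.1 → y.2 = h x.2 →
      I x ≤ I y := by
    intro x y h hh hxy c hc
    obtain ⟨p, hp, rfl⟩ := hc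
    obtain ⟨h1, h2⟩ := push x y h hh hxy p hp
    exact ⟨_, h1, h2⟩
  -- finite basis
  have basis : ∃ S : Finset (Σ m, X m), ∀ y : Σ m, X m, ∃ x ∈ S,
      (∃ h ∈ H x.1 y.1, y.2 = h x.2) ∧ I x = I y := by
    by_contra hcon
    push Not at hcon
    obtain ⟨s, -, hs⟩ := exists_seq_of_forall_finset_exists (fun _ : Σ m, X m => True)
      (fun x y => ¬ ((∃ h ∈ H x.1 y.1, y.2 = h x.2) ∧ I x = I y)) (by
        intro S _
        obtain ⟨y, hy⟩ := hcon S
        refine ⟨y, trivial, fun x hx hxy => ?_⟩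
        exact hy x hx hxy.1 hxy.2)
    obtain ⟨g, hg, hmon⟩ := wqo s
    obtain ⟨n, hn⟩ := WellFoundedGT.monotone_chain_condition
      (⟨fun i => I (s (g i)), fun i j hij => by
        obtain ⟨h, hh, he⟩ := hmon i j hij
        exact Imono _ _ h hh he⟩ : ℕ →o Submodule k k)
    exact hs (g n) (g (n+1)) (hg (Nat.lt_succ_self n))
      ⟨hmon n (n+1) (Nat.le_succ n), hn (n+1) (Nat.le_succ n)⟩
  obtain ⟨S, hS⟩ := basis
  refine ⟨S.image Sigma.fst, fun m => ?_⟩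
  set V := Submodule.span k
      {q | ∃ m0 ∈ S.image Sigma.fst, ∃ h ∈ H m0 m, ∃ p ∈ N m0, q = Finsupp.mapDomain h p} with hV
  have key : ∀ w : X m, ∀ p ∈ U ⟨m, w⟩, p ∈ V := by
    intro w
    induction w using WellFoundedLT.induction with
    | ind w ih =>
      intro p hp
      obtain ⟨x, hxS, ⟨h, hh, hxy⟩, hI⟩ := hS ⟨m, w⟩
      have hc : p w ∈ I x := by
        rw [hI]
        exact ⟨p, hp, rfl⟩
      obtain ⟨p0, hp0, hp0w⟩ := hc
      obtain ⟨h1, h2⟩ := push x ⟨m, w⟩ h hh hxy p0 hp0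
      have h3 : Finsupp.mapDomain h p0 ∈ V :=
        Submodule.subset_span ⟨x.1, Finset.mem_image_of_mem _ hxS, h, hh, p0, hp0.1, rfl⟩
      set q := p - Finsupp.mapDomain h p0 with hq
      have hqU : q ∈ U ⟨m, w⟩ := Submodule.sub_mem _ hp h1
      have hqw : q w = 0 := by
        have h4 : p0 x.2 = p w := hp0w
        have h5 : Finsupp.mapDomain h p0 w = p0 x.2 := h2
        rw [hq, Finsupp.sub_apply, h5, h4, sub_self]
      have hqV : q ∈ V := by
        by_cases hq0 : q = 0
        · rw [hq0]; exact V.zero_mem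
        · have hne : q.support.Nonempty := Finsupp.support_nonempty_iff.2 hq0
          refine ih (q.support.max' hne) ?_ q ⟨hqU.1, ?_⟩
          · have h6 := q.support.max'_mem hne
            have h7 : q.support.max' hne ≤ w := (Finsupp.mem_supported _ _).1 hqU.2 h6
            refine lt_of_le_of_ne h7 fun h8 => ?_
            rw [h8] at h6
            exact (Finsupp.mem_support_iff.1 h6) hqw
          · rw [SetLike.mem_coe, Finsupp.mem_supported]
            intro z hz
            exact Finset.le_max' _ _ hz
      have : p = q + Finsupp.mapDomain h p0 := by rw [hq]; abel
      rw [this]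
      exact V.add_mem hqV h3
  intro p hp
  by_cases hp0 : p = 0
  · rw [hp0]; exact V.zero_mem
  · have hne : p.support.Nonempty := Finsupp.support_nonempty_iff.2 hp0
    refine key (p.support.max' hne) p ⟨hp, ?_⟩
    rw [SetLike.mem_coe, Finsupp.mem_supported]
    intro z hz
    exact Finset.le_max' _ _ hz

/-- Ordered surjections: `ι` picks the minimum of each fibre and is strictly monotone. -/
def FIBOrdSurj {m m' : ℕ} (h : Fin m' → Fin m) (ι : Fin m → Fin m') : Prop :=
  StrictMono ι ∧ (∀ b, h (ι b) = b) ∧ ∀ c, ι (h c) ≤ c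

theorem fib_lex {A : Type} [LinearOrder A] {m m' : ℕ} {h : Fin m' → Fin m} {ι : Fin m → Fin m'}
    (hh : FIBOrdSurj h ι) (u v : Fin m → A) (huv : toLex u < toLex v) :
    toLex (u ∘ h) < toLex (v ∘ h) := by
  obtain ⟨b, hb1, hb2⟩ := huv
  obtain ⟨h1, h2, h3⟩ := hh
  refine ⟨ι b, fun c hc => ?_, ?_⟩
  · exact hb1 (h c) (h1.lt_iff_lt.1 ((h3 c).trans_lt hc))
  · change u (h (ι b)) < v (h (ι b))
    rw [h2]; exact hb2

/-- first occurrence marker -/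
noncomputable def fibDec {A : Type} {m : ℕ} (w : Fin m → A) (c : Fin m) : Prop × A :=
  (∀ b, b < c → w b ≠ w c, w c)

theorem fib_emb {A : Type} {m m' : ℕ} (w : Fin m → A) (w' : Fin m' → A)
    (hr : Set.range w = Set.range w') (ι : Fin m → Fin m') (hι : StrictMono ι)
    (hd : ∀ b, fibDec w b = fibDec w' (ι b)) :
    ∃ h : Fin m' → Fin m, FIBOrdSurj h ι ∧ w' = w ∘ h := by
  classical
  have hw : ∀ b, w b = w' (ι b) := fun b => congrArg Prod.snd (hd b)
  have hf : ∀ b, (∀ a, a < b → w a ≠ w b) → (∀ c, c < ι b → w' c ≠ w' (ι b)) := fun b hb => by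
    have h := congrArg Prod.fst (hd b)
    exact h.mp hb
  have ex : ∀ c, ∃ b, ι b ≤ c ∧ w' c = w b ∧ (∀ b', c = ι b' → b = b') := by
    intro c
    by_cases hc : ∃ b, c = ι b
    · obtain ⟨b, rfl⟩ := hc
      exact ⟨b, le_rfl, (hw b).symm, fun b' h => hι.injective h⟩
    · have h1 : ∃ b, w b = w' c := by
        have : w' c ∈ Set.range w := hr ▸ ⟨c, rfl⟩
        exact this
      have h2 := WellFounded.has_min (wellFounded_lt (α := Fin m)) {b | w b = w' c} h1
      obtain ⟨b, hb, hmin⟩ := h2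
      have hb' : w b = w' c := hb
      refine ⟨b, ?_, hb'.symm, fun b' h => absurd ⟨b', h⟩ hc⟩
      by_contra hlt
      push Not at hlt
      refine hf b (fun a ha hab => hmin a (hab.trans hb') ha) c hlt ?_
      rw [← hw, hb']
  choose h h1 h2 h3 using ex
  exact ⟨h, ⟨hι, fun b => h3 _ b rfl, h1⟩, funext h2⟩

theorem fib_wqo {J A : Type} [Finite J] [Finite A] (s : ℕ → J × Σ m, (Fin m → A)) :
    ∃ g : ℕ → ℕ, StrictMono g ∧ ∀ i j, i ≤ j → (s (g i)).1 = (s (g j)).1 ∧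
      ∃ (h : Fin (s (g j)).2.1 → Fin (s (g i)).2.1) (ι : _), FIBOrdSurj h ι ∧
        (s (g j)).2.2 = (s (g i)).2.2 ∘ h := by
  classical
  have hig := Set.PartiallyWellOrderedOn.partiallyWellOrderedOn_sublistForall₂
    (α := Prop × A) (r := Eq) (s := Set.univ)
    (Set.partiallyWellOrderedOn_of_wellQuasiOrdered (Finite.wellQuasiOrdered _) _)
  have hfin : (Set.univ : Set (J × Set A)).PartiallyWellOrderedOn Eq :=
    Set.partiallyWellOrderedOn_of_wellQuasiOrdered (Finite.wellQuasiOrdered _) _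
  have : IsPreorder (List (Prop × A)) (List.SublistForall₂ Eq) := {}
  obtain ⟨g1, hg1⟩ := hig.exists_monotone_subseq
    (f := fun i => List.ofFn (fibDec (s i).2.2)) (fun n x _ => Set.mem_univ x)
  obtain ⟨g2, hg2⟩ := hfin.exists_monotone_subseq
    (f := fun i => ((s (g1 i)).1, Set.range (s (g1 i)).2.2)) (fun n => Set.mem_univ _)
  refine ⟨fun i => g1 (g2 i), g1.strictMono.comp g2.strictMono, fun i j hij => ?_⟩
  have e := hg2 i j hij
  refine ⟨(Prod.ext_iff.1 e).1, ?_⟩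
  have hl := hg1 (g2 i) (g2 j) (g2.monotone hij)
  obtain ⟨l, hl1, hl2⟩ := List.sublistForall₂_iff.1 hl
  rw [List.forall₂_eq_eq_eq] at hl1
  subst hl1
  obtain ⟨f, hf⟩ := List.sublist_iff_exists_fin_orderEmbedding_get_eq.1 hl2
  obtain ⟨h, hh⟩ := fib_emb (s (g1 (g2 i))).2.2 (s (g1 (g2 j))).2.2 (Prod.ext_iff.1 e).2
    (fun b => Fin.cast (by simp) (f (Fin.cast (by simp) b)))
    (by
      intro a b hab
      have : f (Fin.cast (by simp) a) < f (Fin.cast (by simp) b) := f.strictMono hab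
      exact this)
    (by
      intro b
      have := hf (Fin.cast (by simp) b)
      rw [List.get_ofFn, List.get_ofFn] at this
      exact this)
  exact ⟨h, _, hh⟩

/-- Pullback along an ordered surjection, a morphism of `FIB`. -/
def fibPull {m m' : ℕ} (h : Fin m' → Fin m) (hh : ∃ ι, FIBOrdSurj h ι) :
    (⟨m⟩ : FIB) ⟶ ⟨m'⟩ :=
  ⟨⟨⟨fun x => x ∘ h, fun _ _ => rfl⟩, rfl⟩, by
    obtain ⟨ι, -, h2, -⟩ := hh
    have key : ∀ x : Fin m → Bool, (x ∘ h) ∘ ι = x := fun x => funext fun b => by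
      simp [h2]
    refine ⟨fun x y hxy => ?_, ⟨⟨fun x => x ∘ ι, fun _ _ => rfl⟩, rfl⟩, key⟩
    have hxy' : x ∘ h = y ∘ h := hxy
    rw [← key x, ← key y, hxy']⟩

theorem fibPull_apply {a : FIB} {m m' : ℕ} (h : Fin m' → Fin m) (hh : ∃ ι, FIBOrdSurj h ι)
    (f : a ⟶ ⟨m⟩) (x : Fin a.n → Bool) : (f ≫ fibPull h hh).1 x = f.1 x ∘ h := rfl

/-- The word attached to a morphism. -/
def fibWord {a b : FIB} (f : a ⟶ b) (c : Fin b.n) : Fin a.n → Bool :=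
  fun i => f.1 (Pi.single i true) c

theorem fibWord_inj {a b : FIB} : Function.Injective (fibWord (a := a) (b := b)) := by
  intro f g hfg
  apply Subtype.ext
  apply SupBotHom.ext
  intro x
  have hx : x = (Finset.univ.filter (fun i => x i = true)).sup
      (fun i => (Pi.single i true : Fin a.n → Bool)) := by
    funext j
    rw [Finset.sup_apply, Bool.eq_iff_iff]
    constructor
    · intro hj
      have h1 : (Pi.single j true : Fin a.n → Bool) j ≤
          (Finset.univ.filter (fun i => x i = true)).sup
            (fun i => (Pi.single i true : Fin a.n → Bool) j) :=
        Finset.le_sup (f := fun i => (Pi.single i true : Fin a.n → Bool) j) (by simp [hj])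
      rw [Pi.single_eq_same] at h1
      exact top_le_iff.1 h1
    · intro hj
      by_contra hxj
      have h2 : (Finset.univ.filter (fun i => x i = true)).sup
            (fun i => (Pi.single i true : Fin a.n → Bool) j) ≤ ⊥ := by
        refine Finset.sup_le fun i hi => ?_
        have hij : j ≠ i := by
          rintro rfl
          exact hxj (by simpa using hi)
        rw [Pi.single_eq_of_ne hij]
        exact le_rfl
      rw [hj] at h2
      exact absurd h2 (by decide)
  rw [hx, map_finset_sup, map_finset_sup]
  congr 1
  funext i c
  exact congrFun (congrFun hfg c) i

theorem fibHom_finite (a b : FIB) : Finite (a ⟶ b) :=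
  Finite.of_injective _ fibWord_inj

/-- The category `FI(B)` of free B-modules with splittable injections is locally
Noetherian: for every left-Noetherian ring `k`, every subfunctor of every finitely
generated functor `FI(B) ⥤ ModuleCat k` is finitely generated. -/
theorem stmt15 : LocallyNoetherian FIB := by
  classical
  intro k _ _ F hF M hM
  obtain ⟨ℓ, Z, α, hα⟩ := hF
  have : ∀ a b : FIB, Finite (a ⟶ b) := fibHom_finite
  let B := Σ j : Fin ℓ, (Fin (Z j).n → Bool)
  let e : B ≃ Fin (Fintype.card B) := Fintype.equivFin B
  let X : ℕ → Type := fun m => Σ j : Fin ℓ, (Z j ⟶ (⟨m⟩ : FIB))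
  let wd : ∀ m, X m → (Fin m → Fin (Fintype.card B)) := fun m x c => e ⟨x.1, fibWord x.2 c⟩
  have wd_eq : ∀ m (x y : X m), x.1 = y.1 → wd m x = wd m y → x = y := by
    rintro m ⟨j, f⟩ ⟨j', f'⟩ h1 h2
    obtain rfl : j = j' := h1
    congr 1
    apply fibWord_inj
    funext c
    have h3 := e.injective (congrFun h2 c)
    exact eq_of_heq (Sigma.mk.inj h3).2
  let code : ∀ m, X m → Fin ℓ ×ₗ Lex (Fin m → Fin (Fintype.card B)) := fun m x =>
    toLex (x.1, toLex (wd m x))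
  have code_inj : ∀ m, Function.Injective (code m) := by
    intro m x y hxy
    have h : (x.1, toLex (wd m x)) = (y.1, toLex (wd m y)) := toLex.injective hxy
    exact wd_eq m x y (congrArg Prod.fst h) (toLex.injective (congrArg Prod.snd h))
  let _ : ∀ m, LinearOrder (X m) := fun m => LinearOrder.lift' (code m) (code_inj m)
  have code_lt : ∀ m (x y : X m), x < y ↔ code m x < code m y := fun m x y => Iff.rfl
  have : ∀ m, Finite (X m) := fun m => inferInstanceAs (Finite (Σ j : Fin ℓ, (Z j ⟶ _)))
  let act : ∀ {m m' : ℕ}, ((⟨m⟩ : FIB) ⟶ ⟨m'⟩) → X m → X m' := fun φ x => ⟨x.1, x.2 ≫ φ⟩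
  have act_wd : ∀ {m m' : ℕ} (h : Fin m' → Fin m) (hh) (x : X m),
      wd m' (act (fibPull h hh) x) = wd m x ∘ h := fun h hh x => rfl
  let H : ∀ m m', Set (X m → X m') := fun m m' =>
    {a | ∃ (h : Fin m' → Fin m) (hh : ∃ ι, FIBOrdSurj h ι), a = act (fibPull h hh)}
  let v : ∀ m, X m → F.obj ⟨m⟩ := fun m x => F.map x.2 (α x.1)
  let π : ∀ m, (X m →₀ k) →ₗ[k] F.obj ⟨m⟩ := fun m => Finsupp.linearCombination k (v m)
  have π_surj : ∀ m, Function.Surjective (π m) := by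
    intro m
    rw [← LinearMap.range_eq_top, Finsupp.range_linearCombination, hα ⟨m⟩]
    congr 1
    ext y
    constructor
    · rintro ⟨x, rfl⟩
      exact ⟨x.1, x.2, rfl⟩
    · rintro ⟨j, h, rfl⟩
      exact ⟨⟨j, h⟩, rfl⟩
  have π_nat : ∀ {m m' : ℕ} (φ : (⟨m⟩ : FIB) ⟶ ⟨m'⟩) (p : X m →₀ k),
      π m' (Finsupp.mapDomain (act φ) p) = F.map φ (π m p) := by
    intro m m' φ p
    change Finsupp.linearCombination k (v m') _ =
      (F.map φ).hom (Finsupp.linearCombination k (v m) p)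
    rw [Finsupp.linearCombination_mapDomain, Finsupp.apply_linearCombination]
    congr 2
    funext x
    simp [v, act]
  obtain ⟨D, hD⟩ := fib_core (k := k) X H
    (by
      rintro m m' _ ⟨h, hh, rfl⟩ x y hxy
      rw [code_lt] at hxy ⊢
      obtain ⟨ι, hι⟩ := hh
      rw [Prod.Lex.toLex_lt_toLex] at hxy ⊢
      rcases hxy with h1 | ⟨h1, h2⟩
      · exact Or.inl h1
      · exact Or.inr ⟨h1, fib_lex hι _ _ h2⟩)
    (by
      intro s
      obtain ⟨g, hg, hmon⟩ := fib_wqo (fun i => ((s i).2.1, (⟨(s i).1, wd _ (s i).2⟩ :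
        Σ m, (Fin m → Fin (Fintype.card B)))))
      refine ⟨g, hg, fun i j hij => ?_⟩
      obtain ⟨h1, h, ι, hι, h2⟩ := hmon i j hij
      refine ⟨_, ⟨h, ⟨ι, hι⟩, rfl⟩, ?_⟩
      exact wd_eq _ _ _ h1.symm h2)
    (fun m => (M ⟨m⟩).comap (π m))
    (by
      rintro m m' _ ⟨h, hh, rfl⟩ p hp
      rw [Submodule.mem_comap] at hp ⊢
      rw [π_nat]
      exact hM _ _ hp)
  have noeth : ∀ m : ℕ, IsNoetherian k (F.obj ⟨m⟩) := fun m =>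
    isNoetherian_of_surjective (π m) (LinearMap.range_eq_top.2 (π_surj m))
  have fg : ∀ m : ℕ, ∃ G : Finset (F.obj ⟨m⟩), Submodule.span k (G : Set (F.obj ⟨m⟩)) = M ⟨m⟩ :=
    fun m => (noeth m).noetherian (M ⟨m⟩)
  choose G hG using fg
  let T : Finset (Σ m : ℕ, F.obj (⟨m⟩ : FIB)) := D.sigma G
  let en := T.equivFin.symm
  have hT : ∀ t : T, t.1.2 ∈ M ⟨t.1.1⟩ := by
    intro t
    rw [← hG]
    exact Submodule.subset_span (Finset.mem_sigma.1 t.2).2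
  refine ⟨T.card, fun j => ⟨(en j).1.1⟩, fun j => (en j).1.2, fun j => hT _, ?_⟩
  rintro ⟨m⟩
  apply le_antisymm
  · intro y hy
    obtain ⟨p, rfl⟩ := π_surj m y
    have hp := hD m (show p ∈ (M ⟨m⟩).comap (π m) from hy)
    have hp2 := Submodule.mem_map_of_mem (f := π m) hp
    rw [Submodule.map_span] at hp2
    refine (Submodule.span_le.2 ?_) hp2
    rintro _ ⟨_, ⟨m0, hm0, _, ⟨h, hh, rfl⟩, p0, hp0, rfl⟩, rfl⟩
    rw [SetLike.mem_coe, π_nat]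
    have hx : π m0 p0 ∈ Submodule.span k (G m0 : Set (F.obj ⟨m0⟩)) := by
      rw [hG]; exact hp0
    have hx2 := Submodule.mem_map_of_mem (f := (F.map (fibPull h hh)).hom) hx
    rw [Submodule.map_span] at hx2
    refine (Submodule.span_mono ?_) hx2
    rintro _ ⟨z, hz, rfl⟩
    have hzT : (⟨m0, z⟩ : Σ m : ℕ, F.obj (⟨m⟩ : FIB)) ∈ T := Finset.mem_sigma.2 ⟨hm0, hz⟩
    obtain ⟨j, hj⟩ := en.surjective ⟨_, hzT⟩
    have : ∀ t : T, t = ⟨⟨m0, z⟩, hzT⟩ → ∃ φ : (⟨t.1.1⟩ : FIB) ⟶ ⟨m⟩,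
        (F.map (fibPull h hh)).hom z = F.map φ t.1.2 := by
      rintro _ rfl
      exact ⟨_, rfl⟩
    obtain ⟨φ, hφ⟩ := this _ hj
    exact ⟨j, φ, hφ⟩
  · refine Submodule.span_le.2 ?_
    rintro _ ⟨j, h, rfl⟩
    exact hM h _ (hT _)
end

section
/- Let F(B) be the category with objects the natural numbers and with Hom(n, m) the set of injective SupBotHoms (Fin n → Bool) → (Fin m → Bool) (injections of free B-modules), with composition of functions. Then F(B) is locally Noetherian: for every left-Noetherian ring k and every finitely generated functor F : F(B) ⥤ ModuleCat k, every subfunctor of F is finitely generated. -/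
open CategoryTheory

/-- Objects of the category `F(B)`: natural numbers, indexing the free B-modules
`Fin n → Bool`. -/
structure FB : Type where
  n : ℕ

/-- The category `F(B)`: morphisms `a ⟶ b` are the injective `SupBotHom`s
`(Fin a → Bool) → (Fin b → Bool)` (injections of free B-modules). -/
instance : Category.{0} FB where
  Hom a b := {f : SupBotHom (Fin a.n → Bool) (Fin b.n → Bool) // Function.Injective f}
  id a := ⟨SupBotHom.id _, fun _ _ h => h⟩
  comp f g := ⟨g.1.comp f.1, fun _ _ h => f.2 (g.2 h)⟩
  id_comp f := Subtype.ext (SupBotHom.comp_id f.1)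
  comp_id f := Subtype.ext (SupBotHom.id_comp f.1)
  assoc f g h := Subtype.ext (SupBotHom.comp_assoc h.1 g.1 f.1).symm

/-- A reflexive well-quasi-order has a finite basis. -/
theorem wqo_finite_basis {α : Type*} {r : α → α → Prop} (h : WellQuasiOrdered r) :
    ∃ T : Finset α, ∀ y, ∃ x ∈ T, r x y := by
  by_contra hc
  push Not at hc
  obtain ⟨f, -, hf⟩ := exists_seq_of_forall_finset_exists (fun _ : α => True)
    (fun x y => ¬ r x y) (fun s _ => by
      obtain ⟨y, hy⟩ := hc s
      exact ⟨y, trivial, hy⟩)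
  obtain ⟨m, n, hmn, hr⟩ := h f
  exact hf m n hmn hr

/-- Refining a well-quasi-order by a monotone map into an ACC poset. -/
theorem wqo_refine {α : Type*} {r : α → α → Prop} [IsPreorder α r] (h : WellQuasiOrdered r)
    {k : Type} [Ring k] [IsNoetherianRing k] (I : α → Ideal k)
    (hI : ∀ x y, r x y → I x ≤ I y) :
    WellQuasiOrdered (fun x y => r x y ∧ I x = I y) := by
  intro f
  obtain ⟨g, hg⟩ := h.exists_monotone_subseq f
  obtain ⟨n, hn⟩ := (monotone_stabilizes_iff_noetherian (R := k) (M := k)).2 inferInstance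
    ⟨fun n => I (f (g n)), fun a b hab => hI _ _ (hg a b hab)⟩
  exact ⟨g n, g (n + 1), g.strictMono (Nat.lt_succ_self n), hg _ _ (Nat.le_succ n),
    hn (n + 1) (Nat.le_succ n)⟩

/-- Finite generation with generators indexed by an arbitrary finite type. -/
theorem subfunctorFG_of_finite {C : Type*} [Category C] {k : Type} [Ring k]
    (F : C ⥤ ModuleCat.{0} k) (M : ∀ Z : C, Submodule k (F.obj Z)) (hM : IsSubfunctor F M)
    {J : Type*} [Finite J] (Z : J → C) (α : ∀ j, F.obj (Z j)) (hα : ∀ j, α j ∈ M (Z j))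
    (h : ∀ W : C, ∀ x ∈ M W,
      x ∈ Submodule.span k {v | ∃ (j : J) (h : Z j ⟶ W), v = F.map h (α j)}) :
    SubfunctorFG F M := by
  obtain ⟨n, ⟨e⟩⟩ := Finite.exists_equiv_fin J
  refine ⟨n, fun i => Z (e.symm i), fun i => α (e.symm i), fun i => hα _, fun W => ?_⟩
  apply le_antisymm
  · intro x hx
    refine Submodule.span_mono ?_ (h W x hx)
    rintro v ⟨j, hj, rfl⟩
    obtain ⟨i, rfl⟩ := e.symm.surjective j
    exact ⟨i, hj, rfl⟩
  · rw [Submodule.span_le]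
    rintro v ⟨i, hi, rfl⟩
    exact hM hi _ (hα _)

/-- The ideal of leading coefficients at a monomial `w`. -/
def leadIdeal {k : Type} [Ring k] {A : Type} [AddCommGroup A] [Module k A]
    (M N : Submodule k A) (w : A) : Ideal k where
  carrier := {c | ∃ m ∈ M, m - c • w ∈ N}
  add_mem' := by
    rintro a b ⟨m, hm, hmN⟩ ⟨n, hn, hnN⟩
    refine ⟨m + n, M.add_mem hm hn, ?_⟩
    have := N.add_mem hmN hnN
    rwa [show m + n - (a + b) • w = m - a • w + (n - b • w) by rw [add_smul]; abel]
  zero_mem' := ⟨0, M.zero_mem, by simp⟩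
  smul_mem' := by
    rintro a b ⟨m, hm, hmN⟩
    refine ⟨a • m, M.smul_mem a hm, ?_⟩
    have := N.smul_mem a hmN
    rwa [smul_sub, smul_smul] at this

/-- The Groebner argument. -/
theorem groebner {C : Type*} [Category C] {k : Type} [Ring k] [IsNoetherianRing k]
    (F : C ⥤ ModuleCat.{0} k) (M : ∀ Z : C, Submodule k (F.obj Z)) (hM : IsSubfunctor F M)
    (ι : C → Type) [∀ W, Finite (ι W)] [∀ W, LinearOrder (ι W)]
    (v : ∀ W, ι W → F.obj W) (hv : ∀ W, Submodule.span k (Set.range (v W)) = ⊤)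
    (r : (Σ W, ι W) → (Σ W, ι W) → Prop) [IsPreorder _ r] (hwqo : WellQuasiOrdered r)
    (hr : ∀ x y, r x y → ∃ h : x.1 ⟶ y.1, F.map h (v _ x.2) = v _ y.2 ∧
      ∀ u < x.2, ∃ u' < y.2, F.map h (v _ u) = v _ u') :
    SubfunctorFG F M := by
  classical
  let N : ∀ x : (Σ W, ι W), Submodule k (F.obj x.1) :=
    fun x => Submodule.span k (v x.1 '' Set.Iio x.2)
  let I : (Σ W, ι W) → Ideal k := fun x => leadIdeal (M x.1) (N x) (v x.1 x.2)
  have hN : ∀ x y (h : x.1 ⟶ y.1),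
      (∀ u < x.2, ∃ u' < y.2, F.map h (v _ u) = v _ u') →
      ∀ z ∈ N x, F.map h z ∈ N y := by
    intro x y h hu z hz
    have : N x ≤ (N y).comap (F.map h).hom := by
      refine Submodule.span_le.2 ?_
      rintro _ ⟨u, hu', rfl⟩
      obtain ⟨u', hlt, he⟩ := hu u hu'
      change F.map h (v _ u) ∈ N y
      rw [he]
      exact Submodule.subset_span ⟨u', hlt, rfl⟩
    exact this hz
  have hI : ∀ x y, r x y → I x ≤ I y := by
    rintro x y hxy c ⟨m, hm, hmN⟩
    obtain ⟨h, h1, h2⟩ := hr x y hxy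
    refine ⟨F.map h m, hM h m hm, ?_⟩
    have := hN x y h h2 _ hmN
    rwa [map_sub, map_smul, h1] at this
  obtain ⟨T, hT⟩ := wqo_finite_basis (wqo_refine hwqo I hI)
  have hfg : ∀ x, ∃ S : Finset k, Ideal.span (S : Set k) = I x := fun x =>
    IsNoetherian.noetherian (I x)
  choose S hS using hfg
  have hg : ∀ x (c : S x), ∃ m ∈ M x.1, m - (c : k) • v x.1 x.2 ∈ N x := by
    intro x c
    have : (c : k) ∈ I x := by
      rw [← hS x]
      exact Ideal.subset_span c.2
    exact this
  choose g hgM hgN using hg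
  refine subfunctorFG_of_finite F M hM (J := Σ x : T, S x.1) (fun j => j.1.1.1)
    (fun j => g j.1.1 j.2) (fun j => hgM _ _) ?_
  intro W
  set G := Submodule.span k {z | ∃ (j : Σ x : T, S x.1) (h : j.1.1.1 ⟶ W),
    z = F.map h (g j.1.1 j.2)} with hG
  have hset : ∀ s : Set (ι W), (∀ u ∈ s, ∀ x ∈ M W,
      x ∈ Submodule.span k (v W '' Set.Iic u) → x ∈ G) →
      ∀ x ∈ M W, x ∈ Submodule.span k (v W '' s) → x ∈ G := by
    intro s hs x hx hxs
    rcases s.eq_empty_or_nonempty with rfl | hne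
    · have : x = 0 := by simpa using hxs
      rw [this]
      exact G.zero_mem
    · obtain ⟨u, hu⟩ := (Set.toFinite s).exists_maximal hne
      refine hs u hu.1 x hx (Submodule.span_mono (Set.image_mono ?_) hxs)
      intro t ht
      exact (le_total t u).elim id (fun h => hu.2 ht h)
  have hP : ∀ u : ι W, ∀ x ∈ M W, x ∈ Submodule.span k (v W '' Set.Iic u) → x ∈ G := by
    intro u
    induction u using (Finite.wellFounded_of_trans_of_irrefl
      (fun a b : ι W => a < b)).induction with
    | _ u ih =>
    intro x hx hxu
    have hins : Set.Iic u = insert u (Set.Iio u) := Set.Iio_insert.symm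
    rw [hins, Set.image_insert_eq, Submodule.mem_span_insert] at hxu
    obtain ⟨c, z, hz, rfl⟩ := hxu
    have hc : c ∈ I ⟨W, u⟩ := ⟨_, hx, by simpa using hz⟩
    obtain ⟨y, hyT, hyr, hyI⟩ := hT ⟨W, u⟩
    obtain ⟨h, h1, h2⟩ := hr _ _ hyr
    -- an element of G with the same leading coefficient
    have key : ∀ c ∈ I y, ∃ m ∈ G, m ∈ M W ∧ m - c • v W u ∈ N ⟨W, u⟩ := by
      intro c hc
      rw [← hS y] at hc
      induction hc using Submodule.span_induction with
      | mem c hc =>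
        refine ⟨F.map h (g y ⟨c, hc⟩), Submodule.subset_span ⟨⟨⟨y, hyT⟩, ⟨c, hc⟩⟩, h, rfl⟩,
          hM h _ (hgM _ _), ?_⟩
        have := hN y ⟨W, u⟩ h h2 _ (hgN y ⟨c, hc⟩)
        rwa [map_sub, map_smul, h1] at this
      | zero => exact ⟨0, G.zero_mem, (M W).zero_mem, by simp⟩
      | add a b _ _ iha ihb =>
        obtain ⟨m, hm, hm', hmN⟩ := iha
        obtain ⟨n, hn, hn', hnN⟩ := ihb
        refine ⟨m + n, G.add_mem hm hn, (M W).add_mem hm' hn', ?_⟩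
        have := (N ⟨W, u⟩).add_mem hmN hnN
        rwa [show m + n - (a + b) • v W u = m - a • v W u + (n - b • v W u) by
          rw [add_smul]; abel]
      | smul a b _ ihb =>
        obtain ⟨m, hm, hm', hmN⟩ := ihb
        refine ⟨a • m, G.smul_mem a hm, (M W).smul_mem a hm', ?_⟩
        have := (N ⟨W, u⟩).smul_mem a hmN
        rwa [smul_sub, smul_smul] at this
    obtain ⟨m, hmG, hmM, hmN⟩ := key c (hyI ▸ hc)
    have hlow : c • v W u + z - m ∈ G := by
      refine hset (Set.Iio u) (fun t ht => ih t ht) _ ((M W).sub_mem hx hmM) ?_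
      have := Submodule.sub_mem _ hz hmN
      rwa [show z - (m - c • v W u) = c • v W u + z - m by abel] at this
    simpa using G.add_mem hlow hmG
  intro x hx
  refine hset Set.univ (fun u _ => hP u) x hx ?_
  rw [Set.image_univ, hv]
  trivial

/-- Higman's lemma over a finite alphabet. -/
theorem higman_finite {A : Type} [Finite A] :
    WellQuasiOrdered (fun l l' : List A => l.Sublist l') := by
  have h := Set.PartiallyWellOrderedOn.partiallyWellOrderedOn_sublistForall₂
    (fun a b : A => a = b) (s := Set.univ) (Set.toFinite _).partiallyWellOrderedOn
  intro f
  obtain ⟨m, n, hmn, hs⟩ := h (fun n => ⟨f n, fun x _ => Set.mem_univ x⟩)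
  refine ⟨m, n, hmn, ?_⟩
  obtain ⟨l, h1, h2⟩ := List.sublistForall₂_iff.1 hs
  rw [List.forall₂_eq_eq_eq] at h1
  subst h1
  exact h2

open Classical in
/-- A word with its letters decorated by a first-occurrence flag. -/
noncomputable def decor {A : Type} {m : ℕ} (w : Fin m → A) : List (A × Bool) :=
  List.ofFn (fun q => (w q, decide (∀ q' < q, w q' ≠ w q)))

/-- Combinatorial heart: divisibility of words by ordered surjections. -/
theorem exists_ordered_surj {A : Type} {m l : ℕ} (w : Fin m → A) (w' : Fin l → A)
    (hset : Set.range w = Set.range w') (hsub : (decor w).Sublist (decor w')) :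
    ∃ (s : Fin l → Fin m) (p : Fin m → Fin l), StrictMono p ∧ (∀ i, s (p i) = i) ∧
      (∀ q, p (s q) ≤ q) ∧ ∀ q, w (s q) = w' q := by
  classical
  obtain ⟨f, hf⟩ := List.sublist_iff_exists_fin_orderEmbedding_get_eq.1 hsub
  have e1 : (decor w).length = m := by simp [decor]
  have e2 : (decor w').length = l := by simp [decor]
  let p : Fin m → Fin l := fun i => Fin.cast e2 (f (Fin.cast e1.symm i))
  have hp : StrictMono p := by
    intro a b hab
    have : f (Fin.cast e1.symm a) < f (Fin.cast e1.symm b) := f.lt_iff_lt.2 hab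
    exact this
  have hpw : ∀ i, w i = w' (p i) ∧
      ((∀ q' < i, w q' ≠ w i) ↔ (∀ q' < p i, w' q' ≠ w' (p i))) := by
    intro i
    have h := hf (Fin.cast e1.symm i)
    have h1 : (decor w).get (Fin.cast e1.symm i) = (w i, decide (∀ q' < i, w q' ≠ w i)) := by
      unfold decor
      rw [List.get_ofFn]
      rfl
    have h2 : (decor w').get (f (Fin.cast e1.symm i)) =
        (w' (p i), decide (∀ q' < p i, w' q' ≠ w' (p i))) := by
      unfold decor
      rw [List.get_ofFn]
      rfl
    rw [h1, h2, Prod.mk.injEq, decide_eq_decide] at h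
    exact h
  have hfirst : ∀ q : Fin l, ∃ i : Fin m, w i = w' q ∧ p i ≤ q := by
    intro q
    have : w' q ∈ Set.range w := hset ▸ ⟨q, rfl⟩
    have hne : {i | w i = w' q}.Nonempty := this
    obtain ⟨i, hi⟩ := (Set.toFinite _).exists_minimal hne
    have hi1 : w i = w' q := hi.1
    refine ⟨i, hi1, ?_⟩
    by_contra hlt
    push Not at hlt
    refine (hpw i).2.1 ?_ q hlt ?_
    · intro q' hq' he
      exact absurd (hi.2 (show w q' = w' q from he.trans hi1) hq'.le) (not_le.2 hq')
    · rw [← (hpw i).1, hi1]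
  have hs : ∀ q : Fin l, ∃ i : Fin m, w i = w' q ∧ p i ≤ q ∧ ∀ j, p j = q → i = j := by
    intro q
    by_cases hq : ∃ j, p j = q
    · obtain ⟨j, rfl⟩ := hq
      exact ⟨j, (hpw j).1, le_rfl, fun j' h => (hp.injective h).symm⟩
    · obtain ⟨i, h1, h2⟩ := hfirst q
      exact ⟨i, h1, h2, fun j h => (hq ⟨j, h⟩).elim⟩
  choose s hs1 hs2 hs3 using hs
  exact ⟨s, p, hp, fun i => hs3 _ _ rfl, hs2, hs1⟩

/-- The row of a morphism at index `q`. -/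
def FB.row {a b : FB} (h : a ⟶ b) (q : Fin b.n) : Fin a.n → Bool :=
  fun i => h.1 (Pi.single i true) q

theorem FB.row_injective {a b : FB} {h h' : a ⟶ b} (H : ∀ q, FB.row h q = FB.row h' q) :
    h = h' := by
  classical
  apply Subtype.ext
  apply DFunLike.ext
  intro x
  have hx : x = Finset.univ.sup
      (fun i : Fin a.n => if x i then (Pi.single i true : Fin a.n → Bool) else ⊥) := by
    apply le_antisymm
    · intro i
      by_cases hi : x i = true
      · have := Finset.le_sup (f := fun i : Fin a.n =>
          if x i then (Pi.single i true : Fin a.n → Bool) else ⊥) (Finset.mem_univ i)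
        have := this i
        simp only [hi, if_true, Pi.single_eq_same] at this
        rw [hi]
        exact this
      · simp only [Bool.not_eq_true] at hi
        rw [hi]
        exact Bool.false_le _
    · refine Finset.sup_le fun i _ => ?_
      split_ifs with hi
      · intro j
        by_cases hj : j = i
        · subst hj; simp [hi]
        · rw [Pi.single_eq_of_ne hj]
          exact Bool.false_le _
      · exact bot_le
  rw [hx, map_finset_sup, map_finset_sup]
  refine Finset.sup_congr rfl fun i _ => ?_
  simp only [Function.comp_apply]
  split_ifs
  · funext q
    exact congrFun (H q) i
  · rw [map_bot, map_bot]

/-- The morphism induced by a surjection with a section. -/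
def FB.ofSurj {a b : FB} (s : Fin b.n → Fin a.n) (hs : Function.Surjective s) : a ⟶ b :=
  ⟨{ toFun := fun x => x ∘ s
     map_sup' := fun _ _ => rfl
     map_bot' := rfl }, hs.injective_comp_right⟩

theorem FB.row_comp_ofSurj {a b c : FB} (h : a ⟶ b) (s : Fin c.n → Fin b.n)
    (hs : Function.Surjective s) (q : Fin c.n) :
    FB.row (h ≫ FB.ofSurj s hs) q = FB.row h (s q) := rfl

instance (a b : FB) : Finite (a ⟶ b) :=
  Finite.of_injective (fun h : a ⟶ b => FB.row h) (fun _ _ H => FB.row_injective (congrFun H))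

/-- The category `F(B)` of free B-modules with injections is locally Noetherian: for
every left-Noetherian ring `k`, every subfunctor of every finitely generated functor
`F(B) ⥤ ModuleCat k` is finitely generated. -/
theorem stmt16 : LocallyNoetherian FB := by
  intro k _ _ F hF M hM
  obtain ⟨ℓ, Z, α, hα⟩ := hF
  obtain ⟨c, ⟨e⟩⟩ := Finite.exists_equiv_fin (Σ j, (Fin (Z j).n → Bool))
  let ι : FB → Type := fun W => Σ j, (Z j ⟶ W)
  let word : ∀ {W : FB}, ι W → Fin W.n → Fin c := fun x q => e ⟨x.1, FB.row x.2 q⟩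
  let key : ∀ W : FB, ι W → Fin ℓ ×ₗ Lex (Fin W.n → Fin c) :=
    fun W x => toLex (x.1, toLex (word x))
  have hkey : ∀ W, Function.Injective (key W) := by
    rintro W ⟨j, h⟩ ⟨j', h'⟩ H
    have H' := toLex.injective H
    rw [Prod.mk.injEq] at H'
    obtain ⟨h1, h2⟩ := H'
    dsimp only at h1
    subst h1
    have h3 := toLex.injective h2
    have : h = h' := by
      apply FB.row_injective
      intro q
      have := e.injective (congrFun h3 q)
      simpa using this
    rw [this]
  letI : ∀ W, LinearOrder (ι W) := fun W => LinearOrder.lift' (key W) (hkey W)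
  have hlt : ∀ W (x y : ι W), x < y ↔ x.1 < y.1 ∨ (x.1 = y.1 ∧
      ∃ i, (∀ t < i, word x t = word y t) ∧ word x i < word y i) := by
    intro W x y
    change key W x < key W y ↔ _
    rw [Prod.Lex.lt_iff]
    rfl
  let tag : (Σ W, ι W) → Fin ℓ × Set (Fin c) := fun x => (x.2.1, Set.range (word x.2))
  let r : (Σ W, ι W) → (Σ W, ι W) → Prop := fun x y =>
    tag x = tag y ∧ (decor (word x.2)).Sublist (decor (word y.2))
  haveI : IsPreorder _ r :=
    { refl := fun x => ⟨rfl, List.Sublist.refl _⟩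
      trans := fun x y z h1 h2 => ⟨h1.1.trans h2.1, h1.2.trans h2.2⟩ }
  have hwqo : WellQuasiOrdered r := by
    have h1 : WellQuasiOrdered (fun a b : Fin ℓ × Set (Fin c) => a = b) :=
      Finite.wellQuasiOrdered _
    have h2 := WellQuasiOrdered.prod h1 (higman_finite (A := Fin c × Bool))
    intro f
    exact h2 (fun n => (tag (f n), decor (word (f n).2)))
  refine groebner F M hM ι (fun W x => F.map x.2 (α x.1)) ?_ r hwqo ?_
  · intro W
    rw [hα W]
    congr 1
    ext z
    constructor
    · rintro ⟨x, rfl⟩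
      exact ⟨x.1, x.2, rfl⟩
    · rintro ⟨j, h, rfl⟩
      exact ⟨⟨j, h⟩, rfl⟩
  · rintro ⟨A, j, h⟩ ⟨B, j', h'⟩ ⟨ht, hsub⟩
    obtain ⟨h1, h2⟩ := Prod.mk.inj ht
    dsimp only at h1
    subst h1
    obtain ⟨s, p, hp, hsp, hps, hw⟩ := exists_ordered_surj _ _ h2 hsub
    have hs : Function.Surjective s := fun i => ⟨p i, hsp i⟩
    have hcomp : h ≫ FB.ofSurj s hs = h' := by
      apply FB.row_injective
      intro q
      rw [FB.row_comp_ofSurj]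
      have := e.injective (hw q)
      simpa using this
    refine ⟨FB.ofSurj s hs, ?_, ?_⟩
    · change F.map (FB.ofSurj s hs) (F.map h (α j)) = F.map h' (α j)
      rw [← hcomp, F.map_comp]
      rfl
    · rintro ⟨j0, g⟩ hg
      refine ⟨⟨j0, g ≫ FB.ofSurj s hs⟩, ?_, ?_⟩
      · rw [hlt] at hg ⊢
        rcases hg with hg | ⟨he, i, hi1, hi2⟩
        · exact Or.inl hg
        · refine Or.inr ⟨he, p i, ?_, ?_⟩
          · intro q hq
            have hsq : s q < i := hp.lt_iff_lt.1 ((hps q).trans_lt hq)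
            have := hi1 (s q) hsq
            rw [← hcomp]
            exact this
          · rw [← hcomp]
            change word (⟨j0, g⟩ : ι A) (s (p i)) < word (⟨j, h⟩ : ι A) (s (p i))
            rw [hsp]
            exact hi2
      · change F.map (FB.ofSurj s hs) (F.map g (α j0)) = F.map (g ≫ FB.ofSurj s hs) (α j0)
        rw [F.map_comp]
        rfl
end

section
/- Let FI(F∞) be the category with objects the natural numbers and with Hom(n, m) the set of injective functions F(n) → F(m) preserving ∔, − and 0 and admitting a left inverse that also preserves ∔, − and 0 (splittable injections of free F∞-modules), with composition of functions. Then FI(F∞) is locally Noetherian: for every left-Noetherian ring k and every finitely generated functor F : FI(F∞) ⥤ ModuleCat k, every subfunctor of F is finitely generated. -/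
open CategoryTheory
open scoped Classical

/-- Nonzero vectors of the free F∞-module of rank `m`. -/
abbrev FVec (m : ℕ) : Type := {σ : Fin m → Option Bool // σ ≠ fun _ => none}

/-- The free F∞-module of rank `m`, with zero `none`. -/
abbrev Fm (m : ℕ) : Type := Option (FVec m)

/-- Negation on the free F∞-module: Boolean negation on each defined value. -/
def Fm.neg {m : ℕ} : Fm m → Fm m :=
  Option.map (fun σ => ⟨fun i => (σ.val i).map (fun b => !b), by
    intro hcontra
    apply σ.prop
    funext i
    have h := congrFun hcontra i
    simpa using h⟩)

/-- Addition on the free F∞-module: `none` absorbs; two nonzero vectors add to `none`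
if they clash in some coordinate, and otherwise to their pointwise merge. -/
noncomputable def Fm.add {m : ℕ} : Fm m → Fm m → Fm m
  | some σ, some τ =>
      if ∃ (i : Fin m) (b : Bool), σ.val i = some b ∧ τ.val i = some (!b) then none
      else some ⟨fun i => (σ.val i).or (τ.val i), by
        intro hcontra
        apply σ.prop
        funext i
        have h := congrFun hcontra i
        cases hv : σ.val i with
        | none => rfl
        | some b => rw [hv] at h; simp [Option.or] at h⟩
  | _, _ => none

/-- A type with F∞-module operations `0`, `∔`, `−`. -/
class FStr (α : Type) where
  z : α
  add : α → α → α
  neg : α → α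

noncomputable instance {m : ℕ} : FStr (Fm m) :=
  ⟨none, Fm.add, Fm.neg⟩

/-- A map preserving `0`, `∔` and `−`. -/
def IsFHom {α β : Type} [FStr α] [FStr β] (f : α → β) : Prop :=
  f FStr.z = FStr.z ∧ (∀ x y, f (FStr.add x y) = FStr.add (f x) (f y)) ∧
    ∀ x, f (FStr.neg x) = FStr.neg (f x)
/-- Objects of the category `FI(F∞)`: natural numbers, indexing the free F∞-modules
`F(n)`. -/
structure FIF : Type where
  n : ℕ

/-- The category `FI(F∞)`: morphisms `a ⟶ b` are the splittable injections of free
F∞-modules, i.e. injective maps `F(a) → F(b)` preserving `∔`, `−` and `0` admitting a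
left inverse that also preserves `∔`, `−` and `0`. -/
noncomputable instance : Category.{0} FIF where
  Hom a b := {f : Fm a.n → Fm b.n //
    IsFHom f ∧ Function.Injective f ∧
      ∃ t : Fm b.n → Fm a.n, IsFHom t ∧ ∀ x, t (f x) = x}
  id a := ⟨id, ⟨rfl, fun _ _ => rfl, fun _ => rfl⟩, fun _ _ h => h,
    ⟨id, ⟨rfl, fun _ _ => rfl, fun _ => rfl⟩, fun _ => rfl⟩⟩
  comp f g := ⟨g.1 ∘ f.1,
    ⟨by simp [Function.comp, f.2.1.1, g.2.1.1],
     fun x y => by simp [Function.comp, f.2.1.2.1, g.2.1.2.1],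
     fun x => by simp [Function.comp, f.2.1.2.2, g.2.1.2.2]⟩,
    fun _ _ h => f.2.2.1 (g.2.2.1 h),
    ⟨f.2.2.2.choose ∘ g.2.2.2.choose,
      ⟨by simp [Function.comp, f.2.2.2.choose_spec.1.1, g.2.2.2.choose_spec.1.1],
       fun x y => by
        simp [Function.comp, f.2.2.2.choose_spec.1.2.1, g.2.2.2.choose_spec.1.2.1],
       fun x => by
        simp [Function.comp, f.2.2.2.choose_spec.1.2.2, g.2.2.2.choose_spec.1.2.2]⟩,
      fun x => by
        simp [Function.comp, f.2.2.2.choose_spec.2, g.2.2.2.choose_spec.2]⟩⟩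
  id_comp f := rfl
  comp_id f := rfl
  assoc f g h := rfl

namespace FIFaux

def coord {m : ℕ} : Fm m → Fin m → Option Bool
  | none => fun _ => none
  | some σ => σ.1

lemma coord_inj {m : ℕ} : Function.Injective (coord (m := m)) := by
  rintro (_ | σ) (_ | τ) h
  · rfl
  · exact absurd h.symm τ.2
  · exact absurd h σ.2
  · exact congrArg some (Subtype.ext h)

lemma fm_ext {m : ℕ} {x y : Fm m} (h : ∀ i b, coord x i = some b ↔ coord y i = some b) :
    x = y := by
  apply coord_inj
  funext i
  exact Option.ext (fun b => h i b)

lemma ne_none_iff {m : ℕ} {x : Fm m} : x ≠ none ↔ ∃ i b, coord x i = some b := by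
  constructor
  · intro hx
    by_contra! hc
    apply hx
    apply fm_ext
    intro i b
    exact iff_of_false (hc i b) (by simp [coord])
  · rintro ⟨i, b, h⟩ rfl
    simp [coord] at h

lemma coord_add {m : ℕ} (x y : Fm m) (i : Fin m) (b : Bool) :
    coord (FStr.add x y) i = some b ↔ x ≠ none ∧ y ≠ none ∧
      (¬ ∃ i b, coord x i = some b ∧ coord y i = some (!b)) ∧
      (coord x i = some b ∨ coord y i = some b) := by
  rcases x with _ | σ
  · simp [FStr.add, Fm.add, coord]
  rcases y with _ | τ
  · simp [FStr.add, Fm.add, coord]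
  by_cases hc : ∃ (i : Fin m) (b : Bool), σ.val i = some b ∧ τ.val i = some (!b)
  · simp only [FStr.add, Fm.add, coord, if_pos hc]
    exact iff_of_false (by simp) (fun h => h.2.2.1 hc)
  · simp only [FStr.add, Fm.add, coord, if_neg hc]
    simp only [ne_eq, reduceCtorEq, not_false_eq_true, hc, true_and]
    have h1 : ∀ b, σ.val i = some b → τ.val i ≠ some (!b) := fun b h h' => hc ⟨i, b, h, h'⟩
    cases hs : σ.val i with
    | none => simp
    | some s =>
      have := h1 s hs
      cases ht : τ.val i with
      | none => simp
      | some t => cases s <;> cases t <;> cases b <;> simp_all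

lemma coord_neg {m : ℕ} (x : Fm m) (i : Fin m) :
    coord (FStr.neg x) i = (coord x i).map (fun b => !b) := by
  rcases x with _ | σ <;> rfl

def pull {m n : ℕ} (φ : Fin n → Fin m) (hφ : Function.Surjective φ) : Fm m → Fm n :=
  Option.map (fun σ => ⟨σ.1 ∘ φ, by
    intro h
    apply σ.2
    funext i
    obtain ⟨p, rfl⟩ := hφ i
    exact congrFun h p⟩)

lemma coord_pull {m n : ℕ} (φ : Fin n → Fin m) (hφ) (x : Fm m) (p : Fin n) :
    coord (pull φ hφ x) p = coord x (φ p) := by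
  rcases x with _ | σ <;> rfl

lemma pull_ne_none {m n : ℕ} (φ : Fin n → Fin m) (hφ) (x : Fm m) :
    pull φ hφ x ≠ none ↔ x ≠ none := by
  rcases x with _ | σ <;> simp [pull]

lemma pull_hom {m n : ℕ} (φ : Fin n → Fin m) (hφ) : IsFHom (pull φ hφ) := by
  refine ⟨rfl, ?_, ?_⟩
  · intro x y
    apply fm_ext
    intro i b
    simp only [coord_pull, coord_add, pull_ne_none]
    rw [hφ.exists]
  · intro x
    apply coord_inj
    funext p
    simp [coord_pull, coord_neg]

def Conf {m n : ℕ} (φ : Fin n → Fin m) (x : Fm n) : Prop :=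
  ∃ p p' b, φ p = φ p' ∧ coord x p = some b ∧ coord x p' = some (!b)

noncomputable def pushRaw {m n : ℕ} (φ : Fin n → Fin m) (x : Fm n) : Fin m → Option Bool :=
  fun i => if Conf φ x then none else
    if ∃ p, φ p = i ∧ coord x p = some true then some true
    else if ∃ p, φ p = i ∧ coord x p = some false then some false else none

noncomputable def push {m n : ℕ} (φ : Fin n → Fin m) (x : Fm n) : Fm m :=
  if h : pushRaw φ x = fun _ => none then none else some ⟨pushRaw φ x, h⟩

lemma coord_push' {m n : ℕ} (φ : Fin n → Fin m) (x : Fm n) :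
    coord (push φ x) = pushRaw φ x := by
  unfold push
  split_ifs with h
  · rw [h]; rfl
  · rfl

lemma coord_push {m n : ℕ} (φ : Fin n → Fin m) (x : Fm n) (i : Fin m) (b : Bool) :
    coord (push φ x) i = some b ↔ ¬ Conf φ x ∧ ∃ p, φ p = i ∧ coord x p = some b := by
  rw [coord_push', pushRaw]
  by_cases hc : Conf φ x
  · simp [hc]
  simp only [hc, if_false, not_false_eq_true, true_and]
  have key : (∃ p, φ p = i ∧ coord x p = some true) →
      ¬ (∃ p, φ p = i ∧ coord x p = some false) := by
    rintro ⟨p, hp, h1⟩ ⟨p', hp', h2⟩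
    exact hc ⟨p, p', true, hp.trans hp'.symm, h1, h2⟩
  by_cases h1 : ∃ p, φ p = i ∧ coord x p = some true
  · rw [if_pos h1]
    cases b
    · simpa using key h1
    · simpa using h1
  · rw [if_neg h1]
    by_cases h2 : ∃ p, φ p = i ∧ coord x p = some false
    · rw [if_pos h2]
      cases b
      · simpa using h2
      · simpa using h1
    · rw [if_neg h2]
      cases b
      · simpa using h2
      · simpa using h1

lemma push_ne_none {m n : ℕ} (φ : Fin n → Fin m) (x : Fm n) :
    push φ x ≠ none ↔ ¬ Conf φ x ∧ x ≠ none := by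
  rw [ne_none_iff, ne_none_iff]
  simp only [coord_push]
  constructor
  · rintro ⟨i, b, hc, p, -, h⟩
    exact ⟨hc, p, b, h⟩
  · rintro ⟨hc, p, b, h⟩
    exact ⟨φ p, b, hc, p, rfl, h⟩

lemma push_hom {m n : ℕ} (φ : Fin n → Fin m) : IsFHom (push φ) := by
  refine ⟨?_, ?_, ?_⟩
  · apply fm_ext
    intro i b
    rw [coord_push]
    simp [coord, FStr.z]
  · intro x y
    apply fm_ext
    intro i b
    rw [coord_add, push_ne_none, push_ne_none]
    simp only [coord_push, coord_add, Conf]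
    constructor
    · rintro ⟨hc, p, hp, hx, hy, hcl, hb⟩
      have hc' : ∀ p p' b, φ p = φ p' → (coord x p = some b ∨ coord y p = some b) →
          (coord x p' = some (!b) ∨ coord y p' = some (!b)) → False := by
        intro p p' b h1 h2 h3
        exact hc ⟨p, p', b, h1, ⟨hx, hy, hcl, h2⟩, hx, hy, hcl, h3⟩
      refine ⟨⟨?_, hx⟩, ⟨?_, hy⟩, ?_, ?_⟩
      · rintro ⟨p, p', b, h1, h2, h3⟩
        exact hc' p p' b h1 (.inl h2) (.inl h3)
      · rintro ⟨p, p', b, h1, h2, h3⟩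
        exact hc' p p' b h1 (.inr h2) (.inr h3)
      · rintro ⟨i, b, ⟨-, p, hp, h2⟩, -, p', hp', h3⟩
        exact hc' p p' b (hp.trans hp'.symm) (.inl h2) (.inr h3)
      · rcases hb with hb | hb
        · left
          exact ⟨fun ⟨p, p', b, h1, h2, h3⟩ => hc' p p' b h1 (.inl h2) (.inl h3), p, hp, hb⟩
        · right
          exact ⟨fun ⟨p, p', b, h1, h2, h3⟩ => hc' p p' b h1 (.inr h2) (.inr h3), p, hp, hb⟩
    · rintro ⟨⟨hcx, hx⟩, ⟨hcy, hy⟩, hcl, hb⟩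
      have hcl' : ∀ p p' b, φ p = φ p' → coord x p = some b → coord y p' = some (!b) → False :=
        fun p p' b h1 h2 h3 => hcl ⟨φ p', b, ⟨hcx, p, h1, h2⟩, hcy, p', rfl, h3⟩
      have hcl2 : ¬ ∃ i b, coord x i = some b ∧ coord y i = some (!b) := by
        rintro ⟨p, b, h2, h3⟩
        exact hcl' p p b rfl h2 h3
      refine ⟨?_, ?_⟩
      · rintro ⟨p, p', b, h1, ⟨-, -, -, h2⟩, -, -, -, h3⟩
        rcases h2 with h2 | h2 <;> rcases h3 with h3 | h3
        · exact hcx ⟨p, p', b, h1, h2, h3⟩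
        · exact hcl' p p' b h1 h2 h3
        · exact hcl' p' p (!b) h1.symm h3 (by simpa using h2)
        · exact hcy ⟨p, p', b, h1, h2, h3⟩
      · rcases hb with ⟨-, p, hp, hb⟩ | ⟨-, p, hp, hb⟩
        · exact ⟨p, hp, hx, hy, hcl2, .inl hb⟩
        · exact ⟨p, hp, hx, hy, hcl2, .inr hb⟩
  · intro x
    have hneg : ∀ {m : ℕ} (x : Fm m) (i : Fin m) (b : Bool),
        coord (FStr.neg x) i = some b ↔ coord x i = some (!b) := by
      intro m x i b
      rw [coord_neg]
      cases coord x i with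
      | none => simp
      | some c => cases b <;> cases c <;> simp
    have hconf : Conf φ (FStr.neg x) ↔ Conf φ x := by
      simp only [Conf, hneg]
      constructor
      · rintro ⟨p, p', b, h1, h2, h3⟩
        exact ⟨p, p', !b, h1, h2, h3⟩
      · rintro ⟨p, p', b, h1, h2, h3⟩
        exact ⟨p, p', !b, h1, by simpa using h2, by simpa using h3⟩
    apply fm_ext
    intro i b
    simp only [hneg, coord_push, hconf]

lemma push_pull {m n : ℕ} (φ : Fin n → Fin m) (hφ : Function.Surjective φ) (x : Fm m) :
    push φ (pull φ hφ x) = x := by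
  apply fm_ext
  intro i b
  simp only [coord_push, Conf, coord_pull]
  constructor
  · rintro ⟨-, p, rfl, h⟩
    exact h
  · intro h
    refine ⟨?_, ?_⟩
    · rintro ⟨p, p', c, h1, h2, h3⟩
      rw [h1, h3] at h2
      simp at h2
    · obtain ⟨p, rfl⟩ := hφ i
      exact ⟨p, rfl, h⟩

def mkHom {a b : FIF} (φ : Fin b.n → Fin a.n) (hφ : Function.Surjective φ) : a ⟶ b :=
  ⟨pull φ hφ, pull_hom φ hφ, Function.LeftInverse.injective (push_pull φ hφ),
    push φ, push_hom φ, push_pull φ hφ⟩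

def word {a b : FIF} (h : a ⟶ b) (p : Fin b.n) : Fm a.n → Option Bool :=
  fun x => coord (h.1 x) p

lemma word_inj {a b : FIF} : Function.Injective (word (a := a) (b := b)) := by
  intro f g h
  apply Subtype.ext
  funext x
  apply coord_inj
  funext p
  exact congrFun (congrFun h p) x

lemma word_comp {a b c : FIF} (h : a ⟶ b) (φ : Fin c.n → Fin b.n) (hφ) :
    word (h ≫ mkHom φ hφ) = word h ∘ φ := by
  funext p x
  exact coord_pull φ hφ (h.1 x) p

instance {a b : FIF} : Finite (a ⟶ b) :=
  inferInstanceAs (Finite {f : Fm a.n → Fm b.n //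
    IsFHom f ∧ Function.Injective f ∧
      ∃ t : Fm b.n → Fm a.n, IsFHom t ∧ ∀ x, t (f x) = x})

noncomputable def flagList {A : Type} {m : ℕ} (w : Fin m → A) : List (A × Prop) :=
  List.ofFn (fun p => (w p, ∀ p' < p, w p' ≠ w p))

lemma exists_ordered {A : Type} {m m' : ℕ} (w : Fin m → A) (w' : Fin m' → A)
    (hr : Set.range w = Set.range w') (hs : (flagList w).Sublist (flagList w')) :
    ∃ (φ : Fin m' → Fin m) (e : Fin m → Fin m'), StrictMono e ∧ (∀ q, φ (e q) = q) ∧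
      (∀ p, e (φ p) ≤ p) ∧ w' = w ∘ φ := by
  obtain ⟨f, hf⟩ := List.sublist_iff_exists_fin_orderEmbedding_get_eq.1 hs
  have hl : (flagList w).length = m := by simp [flagList]
  have hl' : (flagList w').length = m' := by simp [flagList]
  obtain ⟨e, he, hew⟩ : ∃ e : Fin m → Fin m', StrictMono e ∧ ∀ q,
      ((w q, ∀ p' < q, w p' ≠ w q) : A × Prop) =
        (w' (e q), ∀ p' < e q, w' p' ≠ w' (e q)) := by
    refine ⟨fun q => Fin.cast hl' (f (Fin.cast hl.symm q)), ?_, ?_⟩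
    · intro a b hab
      have : f (Fin.cast hl.symm a) < f (Fin.cast hl.symm b) := f.strictMono hab
      exact this
    · intro q
      have := hf (Fin.cast hl.symm q)
      simp only [flagList, List.get_ofFn] at this
      exact this
  have h1 : ∀ q, w q = w' (e q) := fun q => congrArg Prod.fst (hew q)
  have h2 : ∀ q, (∀ p' < q, w p' ≠ w q) → (∀ p' < e q, w' p' ≠ w' (e q)) :=
    fun q h => (congrArg Prod.snd (hew q)).mp h
  have key : ∀ p, ∃ q, w' p = w q ∧ e q ≤ p ∧ (∀ q', e q' = p → q = q') := by
    intro p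
    by_cases hp : ∃ q, e q = p
    · obtain ⟨q, rfl⟩ := hp
      exact ⟨q, (h1 q).symm, le_rfl, fun q' h => (he.injective h).symm⟩
    · have hp2 : w' p ∈ Set.range w := hr ▸ ⟨p, rfl⟩
      have hne : (Finset.univ.filter (fun q => w q = w' p)).Nonempty := by
        obtain ⟨q, hq⟩ := hp2
        exact ⟨q, by simpa using hq⟩
      obtain ⟨q, hq, hmin⟩ := Finset.exists_min_image _ id hne
      simp only [Finset.mem_filter, Finset.mem_univ, true_and, id] at hq hmin
      refine ⟨q, hq.symm, ?_, fun q' h => absurd ⟨q', h⟩ hp⟩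
      by_contra! hlt
      refine h2 q ?_ p hlt ?_
      · intro p' hp' hw
        exact absurd (hmin p' (hw.trans hq)) (not_le.2 hp')
      · rw [← h1, hq]
  choose φ hφ1 hφ2 hφ3 using key
  exact ⟨φ, e, he, fun q => hφ3 _ _ rfl, hφ2, funext hφ1⟩

lemma lex_comp {N m m' : ℕ} (φ : Fin m' → Fin m) (e : Fin m → Fin m') (he : StrictMono e)
    (h1 : ∀ q, φ (e q) = q) (h2 : ∀ p, e (φ p) ≤ p) (v v' : Fin m → Fin N)
    (h : toLex v < toLex v') : toLex (v ∘ φ) < toLex (v' ∘ φ) := by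
  obtain ⟨q, hq1, hq2⟩ := h
  refine ⟨e q, ?_, ?_⟩
  · intro p hp
    exact hq1 (φ p) (he.lt_iff_lt.1 ((h2 p).trans_lt hp))
  · change v (φ (e q)) < v' (φ (e q))
    rw [h1]
    exact hq2

lemma wqo_words (B A : Type) [Finite B] [Finite A] :
    WellQuasiOrdered (fun x y : B × List (A × Prop) => x.1 = y.1 ∧ x.2.Sublist y.2) := by
  have h1 : WellQuasiOrdered (fun x y : B => x = y) := Finite.wellQuasiOrdered _
  have h2 : WellQuasiOrdered (fun x y : List (A × Prop) => x.Sublist y) := by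
    have h := Set.PartiallyWellOrderedOn.partiallyWellOrderedOn_sublistForall₂
      (fun x y : A × Prop => x = y) (s := Set.univ) (Set.toFinite _).partiallyWellOrderedOn
    intro f
    obtain ⟨a, b, hab, hs⟩ := h (fun n => ⟨f n, by simp⟩)
    refine ⟨a, b, hab, ?_⟩
    obtain ⟨l, hl, hl2⟩ := List.sublistForall₂_iff.1 hs
    rw [List.forall₂_eq_eq_eq] at hl
    subst hl
    exact hl2
  exact WellQuasiOrdered.prod h1 h2

/-- Finite basis for a monotone map from a wqo to a Noetherian lattice. -/
lemma finite_basis {Q : Type*} {k : Type} [Ring k] [IsNoetherianRing k] (r : Q → Q → Prop)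
    [IsPreorder Q r] (hr : WellQuasiOrdered r) (L : Q → Submodule k k)
    (hL : ∀ q q', r q q' → L q ≤ L q') :
    ∃ T : Finset Q, ∀ q, ∃ t ∈ T, r t q ∧ L q ≤ L t := by
  by_contra! hc
  obtain ⟨f, -, hf⟩ := exists_seq_of_forall_finset_exists (fun _ : Q => True)
    (fun t q => r t q → ¬ L q ≤ L t) (fun T _ => by
      obtain ⟨q, hq⟩ := hc T
      exact ⟨q, trivial, hq⟩)
  obtain ⟨g, hg⟩ := hr.exists_monotone_subseq f
  obtain ⟨n, hn⟩ := (monotone_stabilizes_iff_noetherian (R := k) (M := k)).2 inferInstance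
    ⟨fun n => L (f (g n)), fun a b hab => hL _ _ (hg a b hab)⟩
  exact hf (g n) (g (n + 1)) (g.strictMono (Nat.lt_succ_self n)) (hg _ _ (Nat.le_succ n))
    (hn (n + 1) (Nat.le_succ n)).ge

section main

variable {k : Type} [Ring k] (F : FIF ⥤ ModuleCat.{0} k) {ℓ : ℕ} (Z : Fin ℓ → FIF)

/-- Indices of the generators of `F(W)`. -/
abbrev Idx (W : FIF) : Type := Σ j : Fin ℓ, (Z j ⟶ W)

/-- The common finite alphabet. -/
abbrev Alph : Type := Σ j : Fin ℓ, (Fm (Z j).n → Option Bool)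

def aword {W : FIF} (i : Idx Z W) (p : Fin W.n) : Alph Z := ⟨i.1, word i.2 p⟩

noncomputable def act {W W' : FIF} (g : W ⟶ W') (i : Idx Z W) : Idx Z W' := ⟨i.1, i.2 ≫ g⟩

lemma aword_act {W W' : FIF} (φ : Fin W'.n → Fin W.n) (hφ) (i : Idx Z W) :
    aword Z (act Z (mkHom φ hφ) i) = aword Z i ∘ φ := by
  funext p
  change (⟨i.1, word (i.2 ≫ mkHom φ hφ) p⟩ : Alph Z) = _
  rw [word_comp]
  rfl

lemma idx_ext {W : FIF} {i i' : Idx Z W} (h1 : i.1 = i'.1) (h2 : aword Z i = aword Z i') :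
    i = i' := by
  obtain ⟨j, h⟩ := i
  obtain ⟨j', h'⟩ := i'
  obtain rfl : j = j' := h1
  congr 1
  apply word_inj
  funext p
  have := congrFun h2 p
  simpa [aword] using this

noncomputable def key {W : FIF} (i : Idx Z W) :
    Fin ℓ ×ₗ Lex (Fin W.n → Fin (Nat.card (Alph Z))) :=
  toLex (i.1, toLex (Finite.equivFin (Alph Z) ∘ aword Z i))

lemma key_inj {W : FIF} : Function.Injective (key Z (W := W)) := by
  intro i i' h
  have h' := toLex.injective h
  have h1 : i.1 = i'.1 := congrArg Prod.fst h'
  have h2 := toLex.injective (congrArg Prod.snd h')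
  exact idx_ext Z h1 ((Finite.equivFin (Alph Z)).injective.comp_left h2)

def Good {W W' : FIF} (g : W ⟶ W') : Prop :=
  ∀ i i' : Idx Z W, key Z i < key Z i' → key Z (act Z g i) < key Z (act Z g i')

abbrev QQ : Type := Σ W : FIF, Idx Z W

noncomputable def enc (q : QQ Z) : (Fin ℓ × Set (Alph Z)) × List (Alph Z × Prop) :=
  ((q.2.1, Set.range (aword Z q.2)), flagList (aword Z q.2))

def rel (q q' : QQ Z) : Prop :=
  (enc Z q).1 = (enc Z q').1 ∧ (enc Z q).2.Sublist (enc Z q').2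

instance : IsPreorder (QQ Z) (rel Z) where
  refl q := ⟨rfl, List.Sublist.refl _⟩
  trans _ _ _ h h' := ⟨h.1.trans h'.1, h.2.trans h'.2⟩

lemma rel_wqo : WellQuasiOrdered (rel Z) := by
  intro f
  exact wqo_words (Fin ℓ × Set (Alph Z)) (Alph Z) (fun n => enc Z (f n))

lemma rel_good {q q' : QQ Z} (h : rel Z q q') :
    ∃ g : q.1 ⟶ q'.1, Good Z g ∧ act Z g q.2 = q'.2 := by
  obtain ⟨h1, h2⟩ := h
  have hj : q.2.1 = q'.2.1 := congrArg Prod.fst h1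
  have hr : Set.range (aword Z q.2) = Set.range (aword Z q'.2) := congrArg Prod.snd h1
  obtain ⟨φ, e, he, hφe, heφ, hw⟩ := exists_ordered _ _ hr h2
  have hφ : Function.Surjective φ := fun x => ⟨e x, hφe x⟩
  refine ⟨mkHom φ hφ, ?_, ?_⟩
  · intro i i' hlt
    unfold key at hlt ⊢
    rw [Prod.Lex.toLex_lt_toLex] at hlt ⊢
    rcases hlt with hlt | ⟨heq, hlt⟩
    · exact Or.inl hlt
    · refine Or.inr ⟨heq, ?_⟩
      rw [aword_act, aword_act]
      exact lex_comp φ e he hφe heφ _ _ hlt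
  · apply idx_ext
    · exact hj
    · rw [aword_act, hw]

variable (α : ∀ j, F.obj (Z j)) (M : ∀ W : FIF, Submodule k (F.obj W))

def gen {W : FIF} (i : Idx Z W) : F.obj W := F.map i.2 (α i.1)

lemma map_gen {W W' : FIF} (g : W ⟶ W') (i : Idx Z W) :
    F.map g (gen F Z α i) = gen F Z α (act Z g i) := by
  simp [gen, act]
  rfl

/-- Span of the generators with index less than `i`. -/
def below {W : FIF} (i : Idx Z W) : Submodule k (F.obj W) :=
  Submodule.span k (gen F Z α '' {j | key Z j < key Z i})

lemma map_below {W W' : FIF} (g : W ⟶ W') (hg : Good Z g) (i : Idx Z W) (x : F.obj W)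
    (hx : x ∈ below F Z α i) : F.map g x ∈ below F Z α (act Z g i) := by
  have : below F Z α i ≤ (below F Z α (act Z g i)).comap (F.map g).hom := by
    refine Submodule.span_le.2 ?_
    rintro _ ⟨j, hj, rfl⟩
    change F.map g (gen F Z α j) ∈ below F Z α (act Z g i)
    rw [map_gen]
    exact Submodule.subset_span ⟨_, hg _ _ hj, rfl⟩
  exact this hx

def lead (q : QQ Z) : Submodule k k where
  carrier := {c | ∃ x ∈ M q.1, x - c • gen F Z α q.2 ∈ below F Z α q.2}
  zero_mem' := ⟨0, zero_mem _, by simp⟩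
  add_mem' := by
    rintro a b ⟨x, hx, hx'⟩ ⟨y, hy, hy'⟩
    refine ⟨x + y, add_mem hx hy, ?_⟩
    have := add_mem hx' hy'
    rwa [sub_add_sub_comm, ← add_smul] at this
  smul_mem' := by
    rintro c a ⟨x, hx, hx'⟩
    refine ⟨c • x, Submodule.smul_mem _ _ hx, ?_⟩
    have := Submodule.smul_mem _ c hx'
    rwa [smul_sub, ← mul_smul] at this

lemma lead_mono (hM : IsSubfunctor F M) {q q' : QQ Z} (h : rel Z q q') :
    lead F Z α M q ≤ lead F Z α M q' := by
  obtain ⟨g, hg, hgq⟩ := rel_good Z h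
  rintro c ⟨x, hx, hx'⟩
  refine ⟨F.map g x, hM g x hx, ?_⟩
  have := map_below F Z α g hg _ _ hx'
  rw [map_sub, map_smul, map_gen, hgq] at this
  exact this

lemma exists_objs [IsNoetherianRing k] (hM : IsSubfunctor F M)
    (hα : ∀ W : FIF, (⊤ : Submodule k (F.obj W)) = Submodule.span k (Set.range (gen F Z α))) :
    ∃ T : Finset (QQ Z), ∀ W, M W ≤
      Submodule.span k {v | ∃ t ∈ T, ∃ x ∈ M t.1, ∃ g : t.1 ⟶ W, v = F.map g x} := by
  obtain ⟨T, hT⟩ := finite_basis (rel Z) (rel_wqo Z) (lead F Z α M)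
    (fun _ _ h => lead_mono F Z α M hM h)
  refine ⟨T, fun W => ?_⟩
  set N := Submodule.span k {v | ∃ t ∈ T, ∃ x ∈ M t.1, ∃ g : t.1 ⟶ W, v = F.map g x} with hN
  -- one reduction step
  have step : ∀ (i : Idx Z W) (x : F.obj W), x ∈ M W →
      x ∈ Submodule.span k (gen F Z α '' {j | key Z j ≤ key Z i}) →
      ∃ y ∈ N, x - y ∈ M W ∧ x - y ∈ below F Z α i := by
    intro i x hx hxs
    have hset : {j : Idx Z W | key Z j ≤ key Z i} = insert i {j | key Z j < key Z i} := by
      ext j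
      simp only [Set.mem_ofPred_eq, Set.mem_insert_iff, le_iff_eq_or_lt, (key_inj Z).eq_iff]
    rw [hset, Set.image_insert_eq, Submodule.mem_span_insert] at hxs
    obtain ⟨c, z, hz, rfl⟩ := hxs
    obtain ⟨t, htT, hrel, hle⟩ := hT ⟨W, i⟩
    have hc : c ∈ lead F Z α M ⟨W, i⟩ := ⟨_, hx, by rw [add_sub_cancel_left]; exact hz⟩
    obtain ⟨x', hx', hxb⟩ := hle hc
    obtain ⟨g, hg, hgq⟩ := rel_good Z hrel
    have h3 := map_below F Z α g hg _ _ hxb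
    rw [map_sub, map_smul, map_gen, hgq] at h3
    refine ⟨F.map g x', Submodule.subset_span ⟨t, htT, x', hx', g, rfl⟩,
      sub_mem hx (hM g x' hx'), ?_⟩
    have h4 := sub_mem (show z ∈ below F Z α i from hz) h3
    convert h4 using 1
    simp only
    abel
  have main : ∀ (i : Idx Z W) (x : F.obj W), x ∈ M W →
      x ∈ Submodule.span k (gen F Z α '' {j | key Z j ≤ key Z i}) → x ∈ N := by
    have wf : WellFounded (fun i i' : Idx Z W => key Z i < key Z i') :=
      InvImage.wf (key Z) wellFounded_lt
    intro i
    induction i using wf.induction with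
    | _ i ih =>
    intro x hx hxs
    obtain ⟨y, hy, hxy, hb⟩ := step i x hx hxs
    have hxyN : x - y ∈ N := by
      by_cases hne : (Set.Nonempty {j : Idx Z W | key Z j < key Z i})
      · obtain ⟨j, hj, hmax⟩ := Set.exists_max_image _ (key Z) (Set.toFinite _) hne
        refine ih j hj _ hxy (Submodule.span_mono (Set.image_mono ?_) hb)
        intro a ha
        exact hmax a ha
      · rw [Set.not_nonempty_iff_eq_empty] at hne
        rw [below, hne] at hb
        simp only [Set.image_empty, Submodule.span_empty, Submodule.mem_bot] at hb
        rw [hb]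
        exact zero_mem _
    have := add_mem hxyN hy
    rwa [sub_add_cancel] at this
  intro x hx
  have hxt : x ∈ Submodule.span k (Set.range (gen F Z α (W := W))) := hα W ▸ Submodule.mem_top
  rcases isEmpty_or_nonempty (Idx Z W) with hE | hE
  · rw [Set.range_eq_empty, Submodule.span_empty, Submodule.mem_bot] at hxt
    rw [hxt]
    exact zero_mem _
  · obtain ⟨i, hi⟩ := Finite.exists_max (key Z (W := W))
    refine main i x hx (Submodule.span_mono ?_ hxt)
    rintro _ ⟨j, rfl⟩
    exact ⟨j, hi j, rfl⟩

lemma subfunctor_fg [IsNoetherianRing k] (hM : IsSubfunctor F M)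
    (hα : ∀ W : FIF, (⊤ : Submodule k (F.obj W)) = Submodule.span k (Set.range (gen F Z α))) :
    SubfunctorFG F M := by
  obtain ⟨T, hT⟩ := exists_objs F Z α M hM hα
  have hnoeth : ∀ W, IsNoetherian k (F.obj W) := by
    intro W
    have : Module.Finite k (F.obj W) :=
      ⟨(hα W).symm ▸ Submodule.fg_span (Set.finite_range _)⟩
    exact isNoetherian_of_isNoetherianRing_of_finite k _
  have hfg : ∀ W, ∃ S : Finset (F.obj W), Submodule.span k (S : Set (F.obj W)) = M W :=
    fun W => (hnoeth W).noetherian (M W)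
  choose S hS using hfg
  let ι := Σ t : T, {x // x ∈ S t.1.1}
  let e := Finite.equivFin ι
  refine ⟨Nat.card ι, fun j => (e.symm j).1.1.1, fun j => (e.symm j).2.1, ?_, ?_⟩
  · intro j
    rw [← hS]
    exact Submodule.subset_span (e.symm j).2.2
  · intro W
    apply le_antisymm
    · refine (hT W).trans (Submodule.span_le.2 ?_)
      rintro _ ⟨t, ht, x, hx, g, rfl⟩
      rw [← hS] at hx
      have : Submodule.span k (S t.1 : Set (F.obj t.1)) ≤ (Submodule.span k {v | ∃ (j : Fin (Nat.card ι))
          (h : (e.symm j).1.1.1 ⟶ W), v = F.map h (e.symm j).2.1}).comap (F.map g).hom := by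
        refine Submodule.span_le.2 ?_
        intro s hs
        apply Submodule.subset_span
        obtain ⟨j, hj⟩ := e.symm.surjective (⟨⟨t, ht⟩, ⟨s, hs⟩⟩ : ι)
        refine ⟨j, ?_⟩
        rw [hj]
        exact ⟨g, rfl⟩
      exact this hx
    · refine Submodule.span_le.2 ?_
      rintro _ ⟨j, h, rfl⟩
      refine hM h _ ?_
      rw [← hS]
      exact Submodule.subset_span (e.symm j).2.2

end main

end FIFaux

/-- The category `FI(F∞)` of free F∞-modules with splittable injections is locally
Noetherian: for every left-Noetherian ring `k`, every subfunctor of every finitely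
generated functor `FI(F∞) ⥤ ModuleCat k` is finitely generated. -/
theorem stmt17 : LocallyNoetherian FIF := by
  intro k _ _ F hF M hM
  obtain ⟨ℓ, Z, α, hα⟩ := hF
  refine FIFaux.subfunctor_fg F Z α M hM (fun W => ?_)
  rw [hα W]
  congr 1
  ext v
  constructor
  · rintro ⟨j, h, rfl⟩
    exact ⟨⟨j, h⟩, rfl⟩
  · rintro ⟨⟨j, h⟩, rfl⟩
    exact ⟨j, h, rfl⟩
end
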